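/- arXiv:2212.14420 — 3 statements merged into one kernel-verified Lean document; each statement's English description precedes it below -/
import Mathlib

section
/- Let (S, f) be a lifted partial permutation on k letters. Then the set of crossings of (S, f) is finite; in particular cross(f) is a well-defined non-negative integer. -/
open scoped Classical BigOperators

noncomputable section

/-- The group `G_m` of bijections of `ℤ` generated by the reflections
`x ↦ 1 - x` (about `1/2`) and `x ↦ 2m - 1 - x` (about `m - 1/2`). -/
def Gm (m : ℕ) : Subgroup (Equiv.Perm ℤ) :=
  Subgroup.closure {Equiv.subLeft (1 : ℤ), Equiv.subLeft (2 * (m : ℤ) - 1)}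

/-- `y` lies in the `G_m`-orbit of `x`. -/
def GmRel (m : ℕ) (x y : ℤ) : Prop := ∃ g ∈ Gm m, g x = y

/-- The `G_m`-orbit of an integer. -/
def GmOrbit (m : ℕ) (x : ℤ) : Set ℤ := {y | GmRel m x y}

/-- `(S, f)` is a lifted partial permutation on `k` letters: `S` is a
`G_m`-invariant subset of `ℤ`, `f` is `G_m`-equivariant on `S`, the quotient
`S/G_m` has exactly `k` elements, and the induced map `S/G_m → ℤ/G_m` is
injective.  (The values of `f` off `S` are irrelevant.) -/
structure IsLPP (m k : ℕ) (S : Set ℤ) (f : ℤ → ℤ) : Prop where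
  invariant : ∀ g ∈ Gm m, ∀ x ∈ S, g x ∈ S
  equivariant : ∀ g ∈ Gm m, ∀ x ∈ S, f (g x) = g (f x)
  orbits : (GmOrbit m '' S).ncard = k
  inj : ∀ x ∈ S, ∀ y ∈ S, GmRel m (f x) (f y) → GmRel m x y

/-- `(i, j)` is a crossing pair for `(S, f)`. -/
def IsCrossing (S : Set ℤ) (f : ℤ → ℤ) (i j : ℤ) : Prop :=
  i ∈ S ∧ j ∈ S ∧ i < j ∧ f j < f i

/-- The `G_m`-orbit of the unordered pair `{p.1, p.2}`; two pairs are
equivalent exactly when they have the same `pairOrbit`. -/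
def pairOrbit (m : ℕ) (p : ℤ × ℤ) : Set (Set ℤ) :=
  {A | ∃ g ∈ Gm m, A = {g p.1, g p.2}}

/-- The set of crossings of `(S, f)` (equivalence classes of crossing pairs). -/
def crossings (m : ℕ) (S : Set ℤ) (f : ℤ → ℤ) : Set (Set (Set ℤ)) :=
  pairOrbit m '' {p : ℤ × ℤ | IsCrossing S f p.1 p.2}

/-- The number of crossings `cross(f)`. -/
def crossCount (m : ℕ) (S : Set ℤ) (f : ℤ → ℤ) : ℕ := (crossings m S f).ncard

/-- The set whose cardinality (halved) is the weight `w_j(S, f)`. -/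
def weightSet (j : ℤ) (S : Set ℤ) (f : ℤ → ℤ) : Set ℤ :=
  {i | i ∈ S ∧ (((i : ℚ) < (j : ℚ) - 1/2 ∧ (j : ℚ) - 1/2 < (f i : ℚ)) ∨
    ((f i : ℚ) < (j : ℚ) - 1/2 ∧ (j : ℚ) - 1/2 < (i : ℚ)))}

/-- The weight `w_j(S, f)`. -/
def weight (j : ℤ) (S : Set ℤ) (f : ℤ → ℤ) : ℚ := (weightSet j S f).ncard / 2

/-- The resolution `f_{⟨i,j⟩}` of `f` at the crossing `⟨i, j⟩`. -/
def resolveFun (m : ℕ) (f : ℤ → ℤ) (i j : ℤ) : ℤ → ℤ := fun x =>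
  if h : ∃ g ∈ Gm m, g i = x then h.choose (f j)
  else if h' : ∃ g ∈ Gm m, g j = x then h'.choose (f i)
  else f x

/-- The graph `Γ_f = {(i, f i) : i ∈ S}`. -/
def graphOf (S : Set ℤ) (f : ℤ → ℤ) : Set (ℤ × ℤ) :=
  {p | p.1 ∈ S ∧ p.2 = f p.1}

/-- The `G_m`-orbit of a point of `ℤ × ℤ` under the diagonal action. -/
def GmOrbit2 (m : ℕ) (p : ℤ × ℤ) : Set (ℤ × ℤ) :=
  {q | ∃ g ∈ Gm m, (g p.1, g p.2) = q}

/-- The left endpoint of the image of the unit interval `[a, a+1]` under the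
affine extension of `g` to `ℝ`. -/
def sqIdx (g : Equiv.Perm ℤ) (a : ℤ) : ℤ := min (g a) (g (a + 1))

/-- The `G_m`-orbit of it the unit square indexed by `p`. -/
def sqOrbit (m : ℕ) (p : ℤ × ℤ) : Set (ℤ × ℤ) :=
  {q | ∃ g ∈ Gm m, (sqIdx g p.1, sqIdx g p.2) = q}

/-- `D` is a domain from `(S, f)` to `(T, g)`: a `G_m`-invariant assignment of
multiplicities to unit squares, nonzero on finitely many `G_m`-orbits of
squares, whose corners are governed by the two graphs. -/
def IsHDomain (m : ℕ) (S : Set ℤ) (f : ℤ → ℤ) (T : Set ℤ) (g : ℤ → ℤ)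
    (D : ℤ × ℤ → ℤ) : Prop :=
  (∀ γ ∈ Gm m, ∀ a b : ℤ, D (sqIdx γ a, sqIdx γ b) = D (a, b)) ∧
  (sqOrbit m '' {p : ℤ × ℤ | D p ≠ 0}).Finite ∧
  (∀ i j : ℤ,
    D (i, j) + D (i - 1, j - 1) - D (i, j - 1) - D (i - 1, j) =
      (if (i, j) ∈ graphOf T g then 1 else 0) -
        (if (i, j) ∈ graphOf S f then 1 else 0))


theorem translation_mem_Gm (m : ℕ) (n : ℤ) :
    Equiv.addRight ((2 * (m : ℤ) - 2) * n) ∈ Gm m := by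
  have h₁ : Equiv.subLeft (1 : ℤ) ∈ Gm m := Subgroup.subset_closure (by simp)
  have h₂ : Equiv.subLeft (2 * (m : ℤ) - 1) ∈ Gm m := Subgroup.subset_closure (by simp)
  have h₃ : Equiv.addRight (2 * (m : ℤ) - 2) ∈ Gm m := by
    convert mul_mem h₂ h₁ using 1
    ext x
    simp only [Equiv.coe_addRight, Equiv.Perm.mul_apply, Equiv.subLeft_apply]
    ring
  induction n with
  | zero => simp
  | succ n ih =>
    convert mul_mem ih h₃ using 1
    ext x
    simp only [Equiv.coe_addRight, Equiv.Perm.mul_apply]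
    ring
  | pred n ih =>
    convert mul_mem ih (inv_mem h₃) using 1
    ext x
    simp only [Equiv.coe_addRight, Equiv.Perm.mul_apply, Equiv.Perm.inv_def,
      Equiv.addRight_symm]
    ring

theorem pairOrbit_map (m : ℕ) {g : Equiv.Perm ℤ} (hg : g ∈ Gm m) (p : ℤ × ℤ) :
    pairOrbit m (g p.1, g p.2) = pairOrbit m p := by
  ext A
  constructor
  · rintro ⟨γ, hγ, rfl⟩
    exact ⟨γ * g, mul_mem hγ hg, rfl⟩
  · rintro ⟨γ, hγ, rfl⟩
    exact ⟨γ * g⁻¹, mul_mem hγ (inv_mem hg), by simp⟩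

/-- Equivariance under translations bounds the displacement `f x - x`. -/
theorem IsLPP.exists_abs_sub_le {m k : ℕ} {S : Set ℤ} {f : ℤ → ℤ} (h : IsLPP m k S f)
    (hm : 2 ≤ m) : ∃ B : ℤ, ∀ x ∈ S, |f x - x| ≤ B := by
  have hN : 0 < 2 * (m : ℤ) - 2 := by omega
  refine ⟨∑ r ∈ Finset.Ico 0 (2 * (m : ℤ) - 2), |f r - r|, fun x hx => ?_⟩
  have hfx := h.equivariant _ (translation_mem_Gm m (-(x / (2 * (m : ℤ) - 2)))) x hx
  have hr : x + (2 * (m : ℤ) - 2) * -(x / (2 * (m : ℤ) - 2)) = x % (2 * (m : ℤ) - 2) := by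
    rw [Int.emod_def]; ring
  simp only [Equiv.coe_addRight, hr] at hfx
  have hdisp : f x - x = f (x % (2 * (m : ℤ) - 2)) - x % (2 * (m : ℤ) - 2) := by
    rw [hfx]; linarith
  rw [hdisp]
  exact Finset.single_le_sum (f := fun r => |f r - r|) (fun r _ => abs_nonneg _)
    (Finset.mem_Ico.2 ⟨Int.emod_nonneg _ hN.ne', Int.emod_lt_of_pos _ hN⟩)

/-- The set of crossings of a lifted partial permutation is
finite; in particular `cross(f)` is a well-defined non-negative integer. -/
theorem crossings_finite (m k : ℕ) (hm : 2 ≤ m) (hk0 : 0 < k) (hkm : k < m)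
    (S : Set ℤ) (f : ℤ → ℤ) (h : IsLPP m k S f) :
    (crossings m S f).Finite := by
  obtain ⟨B, hB⟩ := h.exists_abs_sub_le hm
  have hN : 0 < 2 * (m : ℤ) - 2 := by omega
  refine (((Set.finite_Icc 0 (2 * (m : ℤ) - 2)).prod
    (Set.finite_Icc 0 (2 * (m : ℤ) - 2 + 2 * B))).image (pairOrbit m)).subset ?_
  rintro _ ⟨⟨i, j⟩, ⟨hi, hj, hij, hf⟩, rfl⟩
  dsimp only at hi hj hij hf
  refine ⟨_, ?_, pairOrbit_map m (translation_mem_Gm m (-(i / (2 * (m : ℤ) - 2)))) (i, j)⟩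
  have hr := Int.emod_def i (2 * (m : ℤ) - 2)
  have hr₀ := Int.emod_nonneg i hN.ne'
  have hr₁ := Int.emod_lt_of_pos i hN
  have hBi := abs_le.1 (hB i hi)
  have hBj := abs_le.1 (hB j hj)
  simp only [Set.mem_prod, Set.mem_Icc, Equiv.coe_addRight, mul_neg]
  refine ⟨⟨?_, ?_⟩, ?_, ?_⟩ <;> linarith
end
end

section
/- Let (S, f) and (T, g) be lifted partial permutations on k letters with T = f(S). Then cross(g∘f) ≤ cross(f) + cross(g). -/
open scoped Classical BigOperators

noncomputable section

/-- Every element of `G_m` is a translation by a multiple of `2m - 2` or a reflection about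
a half-integer. -/
theorem Gm_apply_eq {m : ℕ} {γ : Equiv.Perm ℤ} (hγ : γ ∈ Gm m) :
    (∃ n : ℤ, ∀ x, γ x = x + (2 * m - 2) * n) ∨ ∃ n : ℤ, ∀ x, γ x = 1 + (2 * m - 2) * n - x := by
  unfold Gm at hγ
  induction hγ using Subgroup.closure_induction with
  | mem γ h =>
    right
    rcases h with rfl | rfl
    · exact ⟨0, fun x => by simp⟩
    · exact ⟨1, fun x => by simp; ring⟩
  | one => exact .inl ⟨0, fun x => by simp⟩
  | mul γ δ _ _ hγ hδ =>
    rcases hγ with ⟨a, ha⟩ | ⟨a, ha⟩ <;> rcases hδ with ⟨b, hb⟩ | ⟨b, hb⟩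
    · exact .inl ⟨a + b, fun x => by rw [Equiv.Perm.mul_apply, ha, hb]; ring⟩
    · exact .inr ⟨a + b, fun x => by rw [Equiv.Perm.mul_apply, ha, hb]; ring⟩
    · exact .inr ⟨a - b, fun x => by rw [Equiv.Perm.mul_apply, ha, hb]; ring⟩
    · exact .inl ⟨a - b, fun x => by rw [Equiv.Perm.mul_apply, ha, hb]; ring⟩
  | inv γ _ hγ =>
    rcases hγ with ⟨a, ha⟩ | ⟨a, ha⟩
    · exact .inl ⟨-a, fun x => by rw [Equiv.Perm.inv_eq_iff_eq, ha]; ring⟩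
    · exact .inr ⟨a, fun x => by rw [Equiv.Perm.inv_eq_iff_eq, ha]; ring⟩

/-- The action of `G_m` on `ℤ` is free. -/
theorem Gm_apply_eq_self {m : ℕ} {γ : Equiv.Perm ℤ} (hγ : γ ∈ Gm m) {a : ℤ} (h : γ a = a)
    (x : ℤ) : γ x = x := by
  rcases Gm_apply_eq hγ with ⟨n, hn⟩ | ⟨n, hn⟩
  · have := hn a
    have := hn x
    omega
  · have h1 := hn a
    have h2 : ((2 * m - 2) * n : ℤ) = 2 * ((m - 1) * n) := by ring
    omega

theorem Gm_addRight_mem (m : ℕ) (n : ℤ) : Equiv.addRight ((2 * m - 2) * n : ℤ) ∈ Gm m := by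
  have h1 : Equiv.addRight (2 * m - 2 : ℤ) ∈ Gm m := by
    have : Equiv.addRight (2 * m - 2 : ℤ) =
        Equiv.subLeft (2 * (m : ℤ) - 1) * Equiv.subLeft (1 : ℤ) := by
      ext x
      simp
      ring
    rw [this]
    exact mul_mem (Subgroup.subset_closure (by simp)) (Subgroup.subset_closure (by simp))
  induction n with
  | zero =>
    convert one_mem (Gm m)
    ext x
    simp
  | succ n ih =>
    convert mul_mem h1 ih using 1
    ext x
    simp
    ring
  | pred n ih =>
    convert mul_mem (inv_mem h1) ih using 1
    ext x
    rw [Equiv.Perm.mul_apply, eq_comm, Equiv.Perm.inv_eq_iff_eq]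
    simp
    ring

theorem pairOrbit_apply {m : ℕ} {γ : Equiv.Perm ℤ} (hγ : γ ∈ Gm m) (i j : ℤ) :
    pairOrbit m (γ i, γ j) = pairOrbit m (i, j) := by
  ext A
  constructor
  · rintro ⟨δ, hδ, rfl⟩
    exact ⟨δ * γ, mul_mem hδ hγ, rfl⟩
  · rintro ⟨δ, hδ, rfl⟩
    exact ⟨δ * γ⁻¹, mul_mem hδ (inv_mem hγ), by simp⟩

namespace IsLPP

variable {m k : ℕ} {S : Set ℤ} {f : ℤ → ℤ}

theorem injOn (hf : IsLPP m k S f) : Set.InjOn f S := by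
  intro x hx y hy hxy
  obtain ⟨γ, hγ, rfl⟩ := hf.inj x hx y hy ⟨1, one_mem _, hxy⟩
  rw [hf.equivariant γ hγ x hx] at hxy
  exact (Gm_apply_eq_self hγ hxy.symm x).symm

theorem add_mem (hf : IsLPP m k S f) {x : ℤ} (hx : x ∈ S) (n : ℤ) :
    x + (2 * m - 2) * n ∈ S :=
  hf.invariant _ (Gm_addRight_mem m n) x hx

theorem map_add (hf : IsLPP m k S f) {x : ℤ} (hx : x ∈ S) (n : ℤ) :
    f (x + (2 * m - 2) * n) = f x + (2 * m - 2) * n :=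
  hf.equivariant _ (Gm_addRight_mem m n) x hx

theorem exists_abs_sub_le_s4 (hf : IsLPP m k S f) (hm : 2 ≤ m) :
    ∃ C : ℤ, ∀ x ∈ S, |f x - x| ≤ C := by
  obtain ⟨C, hC⟩ := ((Set.finite_Ico (0 : ℤ) (2 * m - 2)).image fun x => |f x - x|).bddAbove
  refine ⟨C, fun x hx => ?_⟩
  have hN : (0 : ℤ) < 2 * m - 2 := by omega
  have hmod : x % (2 * m - 2 : ℤ) = x + (2 * m - 2) * -(x / (2 * m - 2)) := by
    rw [Int.emod_def]; ring
  have h := hC (Set.mem_image_of_mem _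
    (Set.mem_Ico.2 ⟨Int.emod_nonneg x hN.ne', Int.emod_lt_of_pos x hN⟩))
  simpa only [hmod, hf.map_add hx, add_sub_add_right_eq_sub] using h

theorem finite_crossings (hf : IsLPP m k S f) (hm : 2 ≤ m) : (crossings m S f).Finite := by
  obtain ⟨C, hC⟩ := hf.exists_abs_sub_le_s4 hm
  have hN : (0 : ℤ) < 2 * m - 2 := by omega
  refine (((Set.finite_Ico (0 : ℤ) (2 * m - 2)).prod
    (Set.finite_Icc (0 : ℤ) (2 * m - 2 + 2 * C))).image (pairOrbit m)).subset ?_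
  rintro _ ⟨⟨i, j⟩, ⟨hi, hj, hij, hfij⟩, rfl⟩
  dsimp only at hi hj hij hfij
  have hmod : i % (2 * m - 2 : ℤ) = i + (2 * m - 2) * -(i / (2 * m - 2)) := by
    rw [Int.emod_def]; ring
  have h0 := Int.emod_nonneg i hN.ne'
  have h1 := Int.emod_lt_of_pos i hN
  rw [hmod] at h0 h1
  have h2 := abs_le.1 (hC i hi)
  have h3 := abs_le.1 (hC j hj)
  refine ⟨(i + (2 * m - 2) * -(i / (2 * m - 2)), j + (2 * m - 2) * -(i / (2 * m - 2))),
    ⟨⟨h0, h1⟩, ⟨?_, ?_⟩⟩, pairOrbit_apply (Gm_addRight_mem m _) i j⟩ <;> dsimp only <;> linarith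

/-- Pulling back the orbit of a pair of values along `f` gives the orbit of the pair. -/
theorem preimage_pairOrbit (hf : IsLPP m k S f) {i j : ℤ} (hi : i ∈ S) (hj : j ∈ S) :
    (fun B => S ∩ f ⁻¹' B) '' pairOrbit m (f i, f j) = pairOrbit m (i, j) := by
  have key : ∀ γ ∈ Gm m, S ∩ f ⁻¹' {γ (f i), γ (f j)} = {γ i, γ j} := by
    intro γ hγ
    have hi' := hf.invariant γ hγ i hi
    have hj' := hf.invariant γ hγ j hj
    rw [← hf.equivariant γ hγ i hi, ← hf.equivariant γ hγ j hj, ← Set.image_pair,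
      Set.inter_comm]
    exact hf.injOn.preimage_image_inter (Set.pair_subset hi' hj')
  ext A
  constructor
  · rintro ⟨_, ⟨γ, hγ, rfl⟩, rfl⟩
    exact ⟨γ, hγ, key γ hγ⟩
  · rintro ⟨γ, hγ, rfl⟩
    exact ⟨_, ⟨γ, hγ, rfl⟩, key γ hγ⟩

end IsLPP

/-- Crossing numbers are subadditive under composition:
`cross(g∘f) ≤ cross(f) + cross(g)`. -/
theorem crossCount_comp_le (m k : ℕ) (hm : 2 ≤ m) (hk0 : 0 < k) (hkm : k < m)
    (S : Set ℤ) (f : ℤ → ℤ) (T : Set ℤ) (g : ℤ → ℤ)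
    (hf : IsLPP m k S f) (hg : IsLPP m k T g) (hT : T = f '' S) :
    crossCount m S (g ∘ f) ≤ crossCount m S f + crossCount m T g := by
  have hsub : crossings m S (g ∘ f) ⊆
      crossings m S f ∪ Set.image (fun B => S ∩ f ⁻¹' B) '' crossings m T g := by
    rintro _ ⟨⟨i, j⟩, ⟨hi, hj, hij, hgf⟩, rfl⟩
    dsimp only [Function.comp_apply] at hi hj hij hgf
    rcases lt_trichotomy (f i) (f j) with h | h | h
    · refine .inr ⟨_, ⟨(f i, f j), ⟨?_, ?_, h, hgf⟩, rfl⟩, hf.preimage_pairOrbit hi hj⟩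
      · exact hT ▸ Set.mem_image_of_mem f hi
      · exact hT ▸ Set.mem_image_of_mem f hj
    · rw [h] at hgf
      exact absurd hgf (lt_irrefl _)
    · exact .inl ⟨(i, j), ⟨hi, hj, hij, h⟩, rfl⟩
  have hfin := hg.finite_crossings hm
  calc crossCount m S (g ∘ f)
      ≤ (crossings m S f ∪ Set.image (fun B => S ∩ f ⁻¹' B) '' crossings m T g).ncard :=
        Set.ncard_le_ncard hsub ((hf.finite_crossings hm).union (hfin.image _))
    _ ≤ (crossings m S f).ncard + _ := Set.ncard_union_le _ _
    _ ≤ crossCount m S f + crossCount m T g := Nat.add_le_add_left (Set.ncard_image_le hfin) _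
end
end

section
/- Let (S, f) be a lifted partial permutation on k letters and ⟨i, j⟩ a crossing of (S, f). Then the resolution (S, f_{⟨i,j⟩}) is a well-defined lifted partial permutation on k letters (independent of the chosen representative of the crossing), and for every l ∈ {1, …, m}, w_l(S, f_{⟨i,j⟩}) ≤ w_l(S, f). -/
open scoped Classical BigOperators

noncomputable section

theorem Gm_cases {m : ℕ} {g : Equiv.Perm ℤ} (hg : g ∈ Gm m) :
    (∃ t : ℤ, ∀ x, g x = x + 2 * (((m : ℤ) - 1) * t)) ∨
      ∃ t : ℤ, ∀ x, g x = 1 + 2 * (((m : ℤ) - 1) * t) - x := by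
  induction hg using Subgroup.closure_induction with
  | mem g hg =>
    rcases hg with rfl | rfl
    · exact .inr ⟨0, fun x => by simp⟩
    · exact .inr ⟨1, fun x => by simp; ring⟩
  | one => exact .inl ⟨0, fun x => by simp⟩
  | mul g h _ _ hg hh =>
    rcases hg with ⟨t, hg⟩ | ⟨t, hg⟩ <;> rcases hh with ⟨s, hh⟩ | ⟨s, hh⟩
    · exact .inl ⟨s + t, fun x => by rw [Equiv.Perm.mul_apply, hg, hh]; ring⟩
    · exact .inr ⟨s + t, fun x => by rw [Equiv.Perm.mul_apply, hg, hh]; ring⟩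
    · exact .inr ⟨t - s, fun x => by rw [Equiv.Perm.mul_apply, hg, hh]; ring⟩
    · exact .inl ⟨t - s, fun x => by rw [Equiv.Perm.mul_apply, hg, hh]; ring⟩
  | inv g _ hg =>
    rcases hg with ⟨t, hg⟩ | ⟨t, hg⟩
    · exact .inl ⟨-t, fun x => by rw [Equiv.Perm.inv_eq_iff_eq, hg]; ring⟩
    · exact .inr ⟨t, fun x => by rw [Equiv.Perm.inv_eq_iff_eq, hg]; ring⟩

theorem addRight_mem_Gm (m : ℕ) (t : ℤ) :
    Equiv.addRight (2 * (((m : ℤ) - 1) * t)) ∈ Gm m := by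
  have h1 : Equiv.subLeft (1 : ℤ) ∈ Gm m := Subgroup.subset_closure (by simp)
  have h2 : Equiv.subLeft (2 * (m : ℤ) - 1) ∈ Gm m := Subgroup.subset_closure (by simp)
  convert (Gm m).zpow_mem ((Gm m).mul_mem h2 h1) t using 1
  have h3 : Equiv.subLeft (2 * (m : ℤ) - 1) * Equiv.subLeft (1 : ℤ) =
      Equiv.addRight (2 * ((m : ℤ) - 1)) := by
    ext x
    simp only [Equiv.Perm.mul_apply, Equiv.subLeft_apply, Equiv.coe_addRight]
    ring
  rw [h3, Equiv.zsmul_addRight, smul_eq_mul]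
  congr 1
  ring

/-- `G_m` acts freely on `ℤ`. -/
theorem Gm_free {m : ℕ} {g h : Equiv.Perm ℤ} (hg : g ∈ Gm m) (hh : h ∈ Gm m) {x : ℤ}
    (hx : g x = h x) : g = h := by
  ext y
  rcases Gm_cases hg with ⟨t, hg⟩ | ⟨t, hg⟩ <;> rcases Gm_cases hh with ⟨s, hh⟩ | ⟨s, hh⟩ <;>
    rw [hg, hh] at hx ⊢ <;> omega

theorem GmRel.smul_left_iff {m : ℕ} {g : Equiv.Perm ℤ} (hg : g ∈ Gm m) {x y : ℤ} :
    GmRel m (g x) y ↔ GmRel m x y := by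
  constructor
  · rintro ⟨h, hh, rfl⟩
    exact ⟨h * g, mul_mem hh hg, rfl⟩
  · rintro ⟨h, hh, rfl⟩
    exact ⟨h * g⁻¹, mul_mem hh (inv_mem hg), by simp⟩

/-- An element of `G_m` carrying one strand of a crossing to the other exchanges them. -/
theorem IsCrossing.swap_of_apply_eq {m k : ℕ} {S : Set ℤ} {f : ℤ → ℤ} (h : IsLPP m k S f)
    {i j : ℤ} (hc : IsCrossing S f i j) {g : Equiv.Perm ℤ} (hg : g ∈ Gm m) (hij : g i = j) :
    g j = i := by
  obtain ⟨hi, -, hlt, hf⟩ := hc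
  have he := h.equivariant g hg i hi
  rw [hij] at he
  rcases Gm_cases hg with ⟨t, hg⟩ | ⟨t, hg⟩ <;> rw [hg] at he hij ⊢ <;> omega

section ResolveFun

variable {m : ℕ} {F : ℤ → ℤ} {i j : ℤ}

theorem resolveFun_of_not_rel {x : ℤ} (hi : ¬ GmRel m i x) (hj : ¬ GmRel m j x) :
    resolveFun m F i j x = F x := by
  exact (dif_neg hi).trans (dif_neg hj)

theorem resolveFun_apply_left {g : Equiv.Perm ℤ} (hg : g ∈ Gm m) :
    resolveFun m F i j (g i) = g (F j) := by
  have h : ∃ g' ∈ Gm m, g' i = g i := ⟨g, hg, rfl⟩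
  unfold resolveFun
  rw [dif_pos h, Gm_free h.choose_spec.1 hg h.choose_spec.2]

theorem resolveFun_apply_right (hF : ∀ g ∈ Gm m, F (g j) = g (F j))
    (hswap : ∀ g ∈ Gm m, g i = j → g j = i) {g : Equiv.Perm ℤ} (hg : g ∈ Gm m) :
    resolveFun m F i j (g j) = g (F i) := by
  by_cases h : ∃ g' ∈ Gm m, g' i = g j
  · obtain ⟨g', hg', he⟩ := h
    have hs := hswap (g⁻¹ * g') (mul_mem (inv_mem hg) hg') (by simp [he])
    have hFi := hF (g⁻¹ * g') (mul_mem (inv_mem hg) hg')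
    rw [hs] at hFi
    rw [← he, resolveFun_apply_left hg', hFi]
    simp
  · have h' : ∃ g' ∈ Gm m, g' j = g j := ⟨g, hg, rfl⟩
    unfold resolveFun
    rw [dif_neg h, dif_pos h', Gm_free h'.choose_spec.1 hg h'.choose_spec.2]

end ResolveFun

/-- The equivariant involution of `ℤ` exchanging `g i` and `g j` for `g ∈ G_m`. -/
def orbitSwap (m : ℕ) (i j : ℤ) : ℤ → ℤ := resolveFun m id i j

section OrbitSwap

variable {m : ℕ} {i j : ℤ} {g : Equiv.Perm ℤ}

theorem orbitSwap_apply_left (hg : g ∈ Gm m) : orbitSwap m i j (g i) = g j :=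
  resolveFun_apply_left hg

theorem orbitSwap_apply_right (hswap : ∀ g ∈ Gm m, g i = j → g j = i) (hg : g ∈ Gm m) :
    orbitSwap m i j (g j) = g i :=
  resolveFun_apply_right (fun _ _ => rfl) hswap hg

theorem orbitSwap_of_not_rel {x : ℤ} (hi : ¬ GmRel m i x) (hj : ¬ GmRel m j x) :
    orbitSwap m i j x = x :=
  resolveFun_of_not_rel hi hj

theorem orbitSwap_cases (hswap : ∀ g ∈ Gm m, g i = j → g j = i) (x : ℤ) :
    (∃ g ∈ Gm m, x = g i ∧ orbitSwap m i j x = g j) ∨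
      (∃ g ∈ Gm m, x = g j ∧ orbitSwap m i j x = g i) ∨
      (¬ GmRel m i x ∧ ¬ GmRel m j x ∧ orbitSwap m i j x = x) := by
  by_cases hi : GmRel m i x
  · obtain ⟨g, hg, rfl⟩ := hi
    exact .inl ⟨g, hg, rfl, orbitSwap_apply_left hg⟩
  by_cases hj : GmRel m j x
  · obtain ⟨g, hg, rfl⟩ := hj
    exact .inr (.inl ⟨g, hg, rfl, orbitSwap_apply_right hswap hg⟩)
  exact .inr (.inr ⟨hi, hj, orbitSwap_of_not_rel hi hj⟩)

theorem orbitSwap_involutive (hswap : ∀ g ∈ Gm m, g i = j → g j = i) :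
    Function.Involutive (orbitSwap m i j) := by
  intro x
  rcases orbitSwap_cases hswap x with ⟨g, hg, rfl, h⟩ | ⟨g, hg, rfl, h⟩ | ⟨-, -, h⟩
  · rw [h, orbitSwap_apply_right hswap hg]
  · rw [h, orbitSwap_apply_left hg]
  · rw [h, h]

theorem orbitSwap_equivariant (hswap : ∀ g ∈ Gm m, g i = j → g j = i) (hg : g ∈ Gm m)
    (x : ℤ) : orbitSwap m i j (g x) = g (orbitSwap m i j x) := by
  rcases orbitSwap_cases hswap x with ⟨h, hh, rfl, e⟩ | ⟨h, hh, rfl, e⟩ | ⟨hi, hj, e⟩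
  · rw [e]
    exact orbitSwap_apply_left (mul_mem hg hh)
  · rw [e]
    exact orbitSwap_apply_right hswap (mul_mem hg hh)
  · have key : ∀ y, GmRel m y (g x) → GmRel m y x := by
      rintro y ⟨h, hh, e⟩
      exact ⟨g⁻¹ * h, mul_mem (inv_mem hg) hh, by simp [e]⟩
    rw [e, orbitSwap_of_not_rel (mt (key i) hi) (mt (key j) hj)]

end OrbitSwap

theorem mem_weightSet_iff {l : ℤ} {S : Set ℤ} {f : ℤ → ℤ} {x : ℤ} :
    x ∈ weightSet l S f ↔ x ∈ S ∧ (x < l ∧ l ≤ f x ∨ f x < l ∧ l ≤ x) := by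
  have h1 : ∀ a : ℤ, (a : ℚ) < (l : ℚ) - 1 / 2 ↔ a < l := by
    refine fun a => ⟨fun h => ?_, fun h => ?_⟩
    · exact_mod_cast (by linarith : (a : ℚ) < l)
    · have : (a : ℚ) + 1 ≤ l := by exact_mod_cast h
      linarith
  have h2 : ∀ a : ℤ, (l : ℚ) - 1 / 2 < (a : ℚ) ↔ l ≤ a := by
    refine fun a => ⟨fun h => ?_, fun h => ?_⟩
    · have : (l : ℚ) < a + 1 := by linarith
      exact Int.lt_add_one_iff.mp (by exact_mod_cast this)
    · have : (l : ℚ) ≤ a := by exact_mod_cast h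
      linarith
  simp only [weightSet, Set.mem_ofPred_eq, h1, h2]

theorem IsLPP.finite_weightSet {m k : ℕ} (hm : 2 ≤ m) {S : Set ℤ} {f : ℤ → ℤ}
    (h : IsLPP m k S f) (l : ℤ) : (weightSet l S f).Finite := by
  have hn : (0 : ℤ) < 2 * ((m : ℤ) - 1) := by omega
  obtain ⟨M, hM⟩ := ((Set.finite_Ico 0 (2 * ((m : ℤ) - 1))).image
    fun r => |f r - r|).bddAbove
  refine (Set.finite_Icc (l - M) (l + M)).subset fun x hx => ?_
  obtain ⟨hxS, hx⟩ := mem_weightSet_iff.mp hx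
  have hbound : |f x - x| ≤ M := by
    have hr : x % (2 * ((m : ℤ) - 1)) =
        Equiv.addRight (2 * (((m : ℤ) - 1) * -(x / (2 * ((m : ℤ) - 1))))) x := by
      rw [Int.emod_def, Equiv.coe_addRight]
      ring
    have he := h.equivariant _ (addRight_mem_Gm m (-(x / (2 * ((m : ℤ) - 1))))) x hxS
    rw [Equiv.coe_addRight] at he hr
    have hle := hM ⟨x % (2 * ((m : ℤ) - 1)),
      ⟨Int.emod_nonneg _ hn.ne', Int.emod_lt_of_pos _ hn⟩, rfl⟩
    simpa only [hr, he, add_sub_add_right_eq_sub] using hle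
  rw [abs_le] at hbound
  constructor <;> omega

section Resolution

variable {m k : ℕ} {S : Set ℤ} {f : ℤ → ℤ} {i j : ℤ}

theorem IsLPP.resolveFun_apply_right (h : IsLPP m k S f) (hc : IsCrossing S f i j)
    {g : Equiv.Perm ℤ} (hg : g ∈ Gm m) : resolveFun m f i j (g j) = g (f i) :=
  _root_.resolveFun_apply_right (fun g hg => h.equivariant g hg j hc.2.1)
    (fun _ hg => hc.swap_of_apply_eq h hg) hg

theorem IsLPP.orbitSwap_mem (h : IsLPP m k S f) (hc : IsCrossing S f i j) {x : ℤ}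
    (hx : x ∈ S) : orbitSwap m i j x ∈ S := by
  rcases orbitSwap_cases (fun _ hg => hc.swap_of_apply_eq h hg) x with
    ⟨g, hg, -, e⟩ | ⟨g, hg, -, e⟩ | ⟨-, -, e⟩ <;> rw [e]
  · exact h.invariant g hg j hc.2.1
  · exact h.invariant g hg i hc.1
  · exact hx

theorem IsLPP.resolveFun_eq_comp (h : IsLPP m k S f) (hc : IsCrossing S f i j) (x : ℤ) :
    resolveFun m f i j x = f (orbitSwap m i j x) := by
  rcases orbitSwap_cases (fun _ hg => hc.swap_of_apply_eq h hg) x with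
    ⟨g, hg, rfl, e⟩ | ⟨g, hg, rfl, e⟩ | ⟨hi, hj, e⟩ <;> rw [e]
  · rw [resolveFun_apply_left hg, h.equivariant g hg j hc.2.1]
  · rw [h.resolveFun_apply_right hc hg, h.equivariant g hg i hc.1]
  · exact resolveFun_of_not_rel hi hj

theorem IsLPP.resolveFun_congr (h : IsLPP m k S f) (hc : IsCrossing S f i j) {i' j' : ℤ}
    (hc' : IsCrossing S f i' j') {g : Equiv.Perm ℤ} (hg : g ∈ Gm m)
    (he : ({g i, g j} : Set ℤ) = {i', j'}) :
    resolveFun m f i' j' = resolveFun m f i j := by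
  funext x
  rw [h.resolveFun_eq_comp hc, h.resolveFun_eq_comp hc']
  congr 1
  have hs : ∀ g ∈ Gm m, g i' = j' → g j' = i' := fun _ hg => hc'.swap_of_apply_eq h hg
  rcases Set.pair_eq_pair_iff.mp he with ⟨rfl, rfl⟩ | ⟨rfl, rfl⟩ <;>
  rcases orbitSwap_cases (fun _ hg => hc.swap_of_apply_eq h hg) x with
    ⟨u, hu, rfl, e⟩ | ⟨u, hu, rfl, e⟩ | ⟨hi, hj, e⟩ <;> rw [e]
  · simpa using orbitSwap_apply_left (i := g i) (j := g j) (mul_mem hu (inv_mem hg))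
  · simpa using orbitSwap_apply_right hs (mul_mem hu (inv_mem hg))
  · exact orbitSwap_of_not_rel (mt (GmRel.smul_left_iff hg).mp hi)
      (mt (GmRel.smul_left_iff hg).mp hj)
  · simpa using orbitSwap_apply_right hs (mul_mem hu (inv_mem hg))
  · simpa using orbitSwap_apply_left (i := g j) (j := g i) (mul_mem hu (inv_mem hg))
  · exact orbitSwap_of_not_rel (mt (GmRel.smul_left_iff hg).mp hj)
      (mt (GmRel.smul_left_iff hg).mp hi)

theorem IsLPP.resolve (h : IsLPP m k S f) (hc : IsCrossing S f i j) :
    IsLPP m k S (resolveFun m f i j) := by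
  have hs : ∀ g ∈ Gm m, g i = j → g j = i := fun _ hg => hc.swap_of_apply_eq h hg
  refine ⟨h.invariant, fun g hg x hx => ?_, h.orbits, fun x hx y hy hxy => ?_⟩
  · rw [h.resolveFun_eq_comp hc, h.resolveFun_eq_comp hc, orbitSwap_equivariant hs hg,
      h.equivariant g hg _ (h.orbitSwap_mem hc hx)]
  · rw [h.resolveFun_eq_comp hc, h.resolveFun_eq_comp hc] at hxy
    obtain ⟨g, hg, e⟩ := h.inj _ (h.orbitSwap_mem hc hx) _ (h.orbitSwap_mem hc hy) hxy
    rw [← orbitSwap_equivariant hs hg] at e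
    exact ⟨g, hg, (orbitSwap_involutive hs).injective e⟩

/-- `orbitSwap` either fixes a point or reverses its order relative to `f`. -/
theorem IsLPP.orbitSwap_reverses (h : IsLPP m k S f) (hc : IsCrossing S f i j) (x : ℤ) :
    orbitSwap m i j x = x ∨
      (x < orbitSwap m i j x ∧ f (orbitSwap m i j x) < f x) ∨
      (orbitSwap m i j x < x ∧ f x < f (orbitSwap m i j x)) := by
  obtain ⟨hi, hj, hlt, hf⟩ := id hc
  rcases orbitSwap_cases (fun _ hg => hc.swap_of_apply_eq h hg) x with
    ⟨g, hg, rfl, e⟩ | ⟨g, hg, rfl, e⟩ | ⟨-, -, e⟩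
  · rw [e, h.equivariant g hg i hi, h.equivariant g hg j hj]
    rcases Gm_cases hg with ⟨t, hg⟩ | ⟨t, hg⟩ <;> simp only [hg] <;> omega
  · rw [e, h.equivariant g hg i hi, h.equivariant g hg j hj]
    rcases Gm_cases hg with ⟨t, hg⟩ | ⟨t, hg⟩ <;> simp only [hg] <;> omega
  · exact .inl e

theorem IsLPP.weight_resolve_le (h : IsLPP m k S f) (hm : 2 ≤ m) (hc : IsCrossing S f i j)
    (l : ℤ) : weight l S (resolveFun m f i j) ≤ weight l S f := by
  have hs : Function.Involutive (orbitSwap m i j) :=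
    orbitSwap_involutive fun _ hg => hc.swap_of_apply_eq h hg
  have key : ∀ x ∈ weightSet l S (resolveFun m f i j), x ∉ weightSet l S f →
      orbitSwap m i j x ∈ weightSet l S f ∧
        orbitSwap m i j x ∉ weightSet l S (resolveFun m f i j) := by
    intro x hx hx'
    have hmem := h.orbitSwap_mem hc (mem_weightSet_iff.mp hx).1
    have hrev := h.orbitSwap_reverses hc x
    simp only [mem_weightSet_iff, h.resolveFun_eq_comp hc, hs x, hmem, true_and] at hx hx' ⊢
    rcases hrev with e | hrev
    · rw [e] at hx
      exact absurd hx hx'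
    · simp only [hx.1, true_and] at hx'
      omega
  have hle : (weightSet l S (resolveFun m f i j)).ncard ≤ (weightSet l S f).ncard := by
    refine Set.ncard_le_ncard_of_injOn
      (fun x => if x ∈ weightSet l S f then x else orbitSwap m i j x) ?_ ?_
      (h.finite_weightSet hm l)
    · intro x hx
      split_ifs with hx'
      · exact hx'
      · exact (key x hx hx').1
    · intro x hx y hy hxy
      dsimp only at hxy
      split_ifs at hxy with hx' hy' hy'
      · exact hxy
      · exact absurd (hxy ▸ hx) (key y hy hy').2
      · exact absurd (hxy ▸ hy) (key x hx hx').2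
      · exact hs.injective hxy
  unfold weight
  gcongr

end Resolution

/-- The resolution of a lifted partial permutation at a
crossing is well defined (it satisfies its defining clauses, and is
independent of the chosen representative of the crossing), it is again a
lifted partial permutation on `k` letters, and it does not increase any of
the weights `w_l` for `l ∈ {1, …, m}`. -/
theorem resolution_wellDefined (m k : ℕ) (hm : 2 ≤ m) (hk0 : 0 < k) (hkm : k < m)
    (S : Set ℤ) (f : ℤ → ℤ) (h : IsLPP m k S f)
    (i j : ℤ) (hc : IsCrossing S f i j) :
    ((∀ x ∈ S, ¬ GmRel m i x → ¬ GmRel m j x → resolveFun m f i j x = f x) ∧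
      (∀ g ∈ Gm m, resolveFun m f i j (g i) = g (f j) ∧
        resolveFun m f i j (g j) = g (f i))) ∧
    (∀ i' j' : ℤ, IsCrossing S f i' j' →
      (∃ g ∈ Gm m, ({g i, g j} : Set ℤ) = {i', j'}) →
      Set.EqOn (resolveFun m f i' j') (resolveFun m f i j) S) ∧
    IsLPP m k S (resolveFun m f i j) ∧
    (∀ l : ℤ, 1 ≤ l → l ≤ (m : ℤ) →
      weight l S (resolveFun m f i j) ≤ weight l S f) := by
  refine ⟨⟨fun x _ hi hj => resolveFun_of_not_rel hi hj,
      fun g hg => ⟨resolveFun_apply_left hg, h.resolveFun_apply_right hc hg⟩⟩,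
    ?_, h.resolve hc, fun l _ _ => h.weight_resolve_le hm hc l⟩
  rintro i' j' hc' ⟨g, hg, he⟩
  rw [h.resolveFun_congr hc hc' hg he]
  exact Set.eqOn_refl _ _
end
end
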